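/- Conformable fractional Noether theorem in Hamiltonian form under an external force: let 0 < α < 1, a < b, L : [a,b]×ℝ×ℝ → ℝ be of class C¹, y : [a,b] → ℝ be left α-differentiable with conformable derivative y^(α)_a, p(x) = (∂L/∂v)(x,y(x),y^(α)_a(x)), and H(x,y,v,ψ) = −L(x,y,v) + ψ·v the Hamiltonian, so that H{y}(x) = H(x,y(x),y^(α)_a(x),p(x)) = −L(x,y(x),y^(α)_a(x)) + p(x)y^(α)_a(x). Assume the hypotheses of the conformable fractional Noether theorem hold (y^(α)_a, p, T, X, G left α-differentiable; y an extremal, i.e. (∂L/∂y) − p^(α)_a = 0; the necessary invariance condition holds on (a,b)), and assume f : (a,b) → ℝ is left α-differentiable with (d^α_a f/dx^α)(x) = (1−α)·p(x)·[ X(x)·(x−a)^{1−2α} − y^(α)_a(x)·T(x)/(x−a)^{α} ] + G^(α)_a(x)·(x−a)^{1−α} on (a,b). Then the quantity p(x)·X(x)·(x−a)^{1−α} − H{y}(x)·T(x) − f(x) has vanishing conformable derivative on (a,b), i.e. it is a conserved quantity. -/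

import Mathlib

open Topology Filter

/-- `f` has left conformable fractional derivative `l` of order `α` starting from `a`,
at the point `x`. -/
def HasConfDerivAt (α a : ℝ) (f : ℝ → ℝ) (l x : ℝ) : Prop :=
  Filter.Tendsto (fun ε : ℝ => (f (x + ε * (x - a) ^ (1 - α)) - f x) / ε)
    (𝓝[≠] (0 : ℝ)) (𝓝 l)

/-- At points `x > a`, having conformable derivative `l` amounts to having ordinary derivative
`l / (x - a) ^ (1 - α)`. -/
theorem hasConfDerivAt_iff_hasDerivAt {α a x l : ℝ} {f : ℝ → ℝ} (hx : a < x) :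
    HasConfDerivAt α a f l x ↔ HasDerivAt f (l / (x - a) ^ (1 - α)) x := by
  have hs : (x - a) ^ (1 - α) ≠ 0 := (Real.rpow_pos_of_pos (sub_pos.2 hx) _).ne'
  unfold HasConfDerivAt
  generalize (x - a) ^ (1 - α) = s at hs ⊢
  have key : Tendsto (fun ε : ℝ => (f (x + ε * s) - f x) / ε) (𝓝[≠] 0) (𝓝 l) ↔
      HasDerivAt (fun ε : ℝ => f (x + ε * s)) l 0 := by
    rw [hasDerivAt_iff_tendsto_slope_zero]
    simp [div_eq_inv_mul]
  rw [key]
  constructor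
  · intro h
    have hg : HasDerivAt (fun t : ℝ => (t - x) / s) (1 / s) x :=
      ((hasDerivAt_id x).sub_const x).div_const s
    have h' : HasDerivAt (fun ε : ℝ => f (x + ε * s)) l ((x - x) / s) := by simpa using h
    refine ((h'.comp x hg).congr_deriv (by ring)).congr_of_eventuallyEq (.of_forall fun t => ?_)
    simp [div_mul_cancel₀ _ hs]
  · intro h
    have hg : HasDerivAt (fun ε : ℝ => x + ε * s) s 0 := by
      simpa using ((hasDerivAt_id (0 : ℝ)).mul_const s).const_add x
    have h' : HasDerivAt f (l / s) (x + 0 * s) := by simpa using h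
    exact (h'.comp 0 hg).congr_deriv (div_mul_cancel₀ _ hs)

/-- Chain rule for a function of three real variables along a curve `t ↦ (t, u t, v t)`,
expressed with partial derivatives. -/
theorem hasDerivAt_along_curve {L : ℝ → ℝ → ℝ → ℝ} {u v : ℝ → ℝ} {u' v' x : ℝ}
    (hL : DifferentiableAt ℝ (fun q : ℝ × ℝ × ℝ => L q.1 q.2.1 q.2.2) (x, u x, v x))
    (hu : HasDerivAt u u' x) (hv : HasDerivAt v v' x) :
    HasDerivAt (fun t => L t (u t) (v t))
      (deriv (fun t => L t (u x) (v x)) x + deriv (fun w => L x w (v x)) (u x) * u'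
        + deriv (fun w => L x (u x) w) (v x) * v') x := by
  have hF := hL.hasFDerivAt
  set F := fderiv ℝ (fun q : ℝ × ℝ × ℝ => L q.1 q.2.1 q.2.2) (x, u x, v x)
  have h1 : deriv (fun t => L t (u x) (v x)) x = F (1, 0, 0) :=
    (hF.comp_hasDerivAt (f := fun t : ℝ => (t, u x, v x)) x ((hasDerivAt_id x).prodMk
      ((hasDerivAt_const x (u x)).prodMk (hasDerivAt_const x (v x))))).deriv
  have h2 : deriv (fun w => L x w (v x)) (u x) = F (0, 1, 0) :=
    (hF.comp_hasDerivAt (f := fun w : ℝ => (x, w, v x)) (u x) ((hasDerivAt_const (u x) x).prodMk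
      ((hasDerivAt_id (u x)).prodMk (hasDerivAt_const (u x) (v x))))).deriv
  have h3 : deriv (fun w => L x (u x) w) (v x) = F (0, 0, 1) :=
    (hF.comp_hasDerivAt (f := fun w : ℝ => (x, u x, w)) (v x) ((hasDerivAt_const (v x) x).prodMk
      ((hasDerivAt_const (v x) (u x)).prodMk (hasDerivAt_id (v x))))).deriv
  have hsum : ((1 : ℝ), u', v') =
      (1, 0, 0) + u' • ((0 : ℝ), (1 : ℝ), (0 : ℝ)) + v' • ((0 : ℝ), (0 : ℝ), (1 : ℝ)) := by
    simp
  refine (hF.comp_hasDerivAt (f := fun t : ℝ => (t, u t, v t)) x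
    ((hasDerivAt_id x).prodMk (hu.prodMk hv))).congr_deriv ?_
  rw [h1, h2, h3, hsum, map_add, map_add, map_smul, map_smul, smul_eq_mul, smul_eq_mul]
  ring

/-- Conformable fractional Noether theorem in Hamiltonian form under the presence of an
external force `f`: with momentum `p = ∂L/∂v` and Hamiltonian
`H(x,y,v,ψ) = −L(x,y,v) + ψv`, so `H{y}(x) = −L(x,y,y^{(α)}_a) + p·y^{(α)}_a`, under the
hypotheses of the conformable Noether theorem and
`(d^α_a f/dx^α) = (1−α)p[ξ(x−a)^{1−2α} − y^{(α)}_a τ/(x−a)^α] + Λ^{(α)}_a(x−a)^{1−α}`,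
the quantity `p·ξ·(x−a)^{1−α} − H{y}·τ − f` has vanishing conformable derivative on
`(a,b)`, i.e. it is a conserved quantity. Here `T,X,G` denote `τ, ξ, Λ` along `y`. -/
theorem conformable_noether_hamiltonian_external_force
    (α a b : ℝ) (hα0 : 0 < α) (hα1 : α < 1) (hab : a < b)
    (L : ℝ → ℝ → ℝ → ℝ)
    (hL : ContDiff ℝ 1 (fun q : ℝ × ℝ × ℝ => L q.1 q.2.1 q.2.2))
    (y yα yαα p pα T Tα X Xα G Gα f : ℝ → ℝ)
    (hy : ∀ x ∈ Set.Icc a b, HasConfDerivAt α a y (yα x) x)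
    (hyα : ∀ x ∈ Set.Ioo a b, HasConfDerivAt α a yα (yαα x) x)
    (hpdef : ∀ x, p x = deriv (fun v => L x (y x) v) (yα x))
    (hp : ∀ x ∈ Set.Ioo a b, HasConfDerivAt α a p (pα x) x)
    (hT : ∀ x ∈ Set.Ioo a b, HasConfDerivAt α a T (Tα x) x)
    (hX : ∀ x ∈ Set.Ioo a b, HasConfDerivAt α a X (Xα x) x)
    (hG : ∀ x ∈ Set.Ioo a b, HasConfDerivAt α a G (Gα x) x)
    (hprod1 : ∀ x ∈ Set.Ioo a b, ∃ l,
      HasConfDerivAt α a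
        (fun t => (-L t (y t) (yα t) + p t * yα t) * T t) l x)
    (hprod2 : ∀ x ∈ Set.Ioo a b, ∃ l,
      HasConfDerivAt α a (fun t => p t * X t * (t - a) ^ (1 - α)) l x)
    (hEL : ∀ x ∈ Set.Ioo a b, deriv (fun u => L x u (yα x)) (y x) - pα x = 0)
    (hinv : ∀ x ∈ Set.Ioo a b,
      deriv (fun t => L t (y x) (yα x)) x * T x
        + deriv (fun u => L x u (yα x)) (y x) * X x
        + deriv (fun v => L x (y x) v) (yα x) *
            (Xα x - yα x * ((α - 1) * T x / (x - a) + Tα x / (x - a) ^ (1 - α)))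
        + L x (y x) (yα x) * Tα x / (x - a) ^ (1 - α) = Gα x)
    (hf : ∀ x ∈ Set.Ioo a b, HasConfDerivAt α a f
      ((1 - α) * p x * (X x * (x - a) ^ (1 - 2 * α) - yα x * T x / (x - a) ^ α)
        + Gα x * (x - a) ^ (1 - α)) x) :
    ∀ x ∈ Set.Ioo a b,
      HasConfDerivAt α a
        (fun t => p t * X t * (t - a) ^ (1 - α)
          - (-L t (y t) (yα t) + p t * yα t) * T t - f t) 0 x := by
  intro x hx
  have hax : a < x := hx.1
  have hr : 0 < x - a := sub_pos.2 hax
  have hs : 0 < (x - a) ^ (1 - α) := Real.rpow_pos_of_pos hr _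
  have dy := (hasConfDerivAt_iff_hasDerivAt hax).1 (hy x ⟨hx.1.le, hx.2.le⟩)
  have dyα := (hasConfDerivAt_iff_hasDerivAt hax).1 (hyα x hx)
  have dp := (hasConfDerivAt_iff_hasDerivAt hax).1 (hp x hx)
  have dT := (hasConfDerivAt_iff_hasDerivAt hax).1 (hT x hx)
  have dX := (hasConfDerivAt_iff_hasDerivAt hax).1 (hX x hx)
  have df := (hasConfDerivAt_iff_hasDerivAt hax).1 (hf x hx)
  have dL := hasDerivAt_along_curve (hL.differentiable one_ne_zero _) dy dyα
  have dw : HasDerivAt (fun t : ℝ => (t - a) ^ (1 - α)) ((1 - α) * (x - a) ^ (-α)) x := by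
    refine (((hasDerivAt_id x).sub_const a).rpow_const (p := 1 - α)
      (Or.inl hr.ne')).congr_deriv ?_
    rw [show 1 - α - 1 = -α by ring, one_mul, id]
  have hinvx := hinv x hx
  have hELx := sub_eq_zero.1 (hEL x hx)
  rw [← hpdef x] at dL hinvx
  rw [hELx] at dL hinvx
  rw [hasConfDerivAt_iff_hasDerivAt hax]
  refine ((((dp.mul dX).mul dw).sub ((dL.neg.add (dp.mul dyα)).mul dT)).sub df).congr_deriv ?_
  have hneg : (x - a) ^ (-α) = (x - a) ^ (1 - α) / (x - a) := by
    rw [← Real.rpow_sub_one hr.ne']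
    congr 1
    ring
  have hdiv : yα x * T x / (x - a) ^ α = yα x * T x * ((x - a) ^ (1 - α) / (x - a)) := by
    rw [← hneg, Real.rpow_neg hr.le, div_eq_mul_inv]
  have hpow : (x - a) ^ (1 - 2 * α) = (x - a) ^ (1 - α) * ((x - a) ^ (1 - α) / (x - a)) := by
    rw [← hneg, ← Real.rpow_add hr]
    congr 1
    ring
  rw [hdiv, hpow, hneg, ← hinvx]
  simp only [Pi.mul_apply, Pi.add_apply, Pi.neg_apply]
  field_simp
  ring
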